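/- Fractional Poisson summation formula: suppose f : ℝ^n → ℂ is continuous with |f(x)| ≤ C(1+|x|)^{-n-δ} for some C, δ > 0, and the restriction to Z^n of the fractional Fourier transform F_α(e_{-α}f)(m) = ∫_{ℝ^n} f(x) A_α^n e_α(m) e^{-2π i (m·x) csc α} dx satisfies ∑_{m∈Z^n} |F_α(e_{-α}f)(m)| < ∞. Then for all x ∈ ℝ^n, ∑_{m∈Z^n} F_α(e_{-α}f)(m) K_{-α}(m,x) = e_{-α}(x) ∑_{k∈Z^n} f(x + k|sin α|). -/

import Mathlib

open MeasureTheory Filter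

noncomputable section

/-- The fractional torus, realized as the cube `[-|sin α|/2, |sin α|/2]^n`. -/
def Tor (α : ℝ) (n : ℕ) : Set (Fin n → ℝ) :=
  Set.univ.pi fun _ => Set.Icc (-(|Real.sin α| / 2)) (|Real.sin α| / 2)

/-- The chirp `e_α(x) = e^{π i |x|² cot α}`. -/
def eA (α : ℝ) {n : ℕ} (x : Fin n → ℝ) : ℂ :=
  Complex.exp (Complex.I * ((Real.pi * (∑ i, x i ^ 2) * (Real.cos α / Real.sin α) : ℝ) : ℂ))

/-- `A_α = √(1 - i cot α)`. -/
def Acoef (α : ℝ) : ℂ := (1 - Complex.I * ((Real.cos α / Real.sin α : ℝ) : ℂ)) ^ (1 / 2 : ℂ)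

/-- The kernel `K_α(m,x) = A_α^n e_α(x) e^{-2π i (m·x) csc α} e_α(m)`. -/
def Kk (α : ℝ) {n : ℕ} (m : Fin n → ℤ) (x : Fin n → ℝ) : ℂ :=
  Acoef α ^ n * eA α x *
    Complex.exp (-(Complex.I * ((2 * Real.pi * (∑ i, (m i : ℝ) * x i) / Real.sin α : ℝ) : ℂ))) *
    eA α fun i => (m i : ℝ)

/-- The `m`-th fractional Fourier coefficient of order `α`. -/
def Fcoef (α : ℝ) {n : ℕ} (f : (Fin n → ℝ) → ℂ) (m : Fin n → ℤ) : ℂ :=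
  ∫ x in Tor α n, f x * Kk α m x

/-- `|sin α|`-periodicity in every coordinate. -/
def Per (α : ℝ) {n : ℕ} (f : (Fin n → ℝ) → ℂ) : Prop :=
  ∀ (x : Fin n → ℝ) (k : Fin n → ℤ), f (fun i => x i + k i * |Real.sin α|) = f x

/-- The fractional Fourier transform of `e_{-α} f` evaluated at `m ∈ ℤ^n`:
`F_α(e_{-α}f)(m) = A_α^n e_α(m) ∫_{ℝ^n} f(x) e^{-2π i (m·x) csc α} dx`. -/
def Fhat (α : ℝ) {n : ℕ} (f : (Fin n → ℝ) → ℂ) (m : Fin n → ℤ) : ℂ :=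
  Acoef α ^ n * eA α (fun i => (m i : ℝ)) *
    ∫ x : Fin n → ℝ, f x *
      Complex.exp (-(Complex.I * ((2 * Real.pi * (∑ i, (m i : ℝ) * x i) / Real.sin α : ℝ) : ℂ)))

section Poisson

variable {d : Type*}

/-- The half-open cube `(0, 1]^d`. -/
def unitCell (d : Type*) : Set (d → ℝ) := {x | ∀ i, x i ∈ Set.Ioc (0 : ℝ) 1}

/-- The inclusion of the integer lattice `ℤ^d` into `ℝ^d`. -/
def intVec (k : d → ℤ) : d → ℝ := fun i => (k i : ℝ)

lemma intVec_add (k l : d → ℤ) : intVec (k + l) = intVec k + intVec l := by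
  ext; simp [intVec]

lemma preimage_add_right_unitCell (k : d → ℤ) :
    (fun x : d → ℝ => x + intVec k) ⁻¹' {x | ∀ i, x i ∈ Set.Ioc (k i : ℝ) (k i + 1)} =
      unitCell d := by
  ext x
  simp [unitCell, intVec, add_comm (x _)]

lemma iUnion_cells :
    ⋃ k : d → ℤ, {x : d → ℝ | ∀ i, x i ∈ Set.Ioc (k i : ℝ) (k i + 1)} = Set.univ := by
  refine Set.eq_univ_of_forall fun x => Set.mem_iUnion.2 ⟨fun i => ⌈x i⌉ - 1, fun i => ?_⟩
  have h₁ := Int.ceil_lt_add_one (x i)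
  have h₂ := Int.le_ceil (x i)
  constructor <;> push_cast <;> linarith

lemma pairwise_disjoint_cells :
    Pairwise (Function.onFun Disjoint fun k : d → ℤ =>
      {x : d → ℝ | ∀ i, x i ∈ Set.Ioc (k i : ℝ) (k i + 1)}) := by
  intro k l hkl
  refine Set.disjoint_left.2 fun x hk hl => hkl (funext fun i => ?_)
  obtain ⟨h₁, h₂⟩ := hk i
  obtain ⟨h₃, h₄⟩ := hl i
  have h₅ : (k i : ℝ) < l i + 1 := by linarith
  have h₆ : (l i : ℝ) < k i + 1 := by linarith
  norm_cast at h₅ h₆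
  lia

lemma tsum_comp_add_intVec_periodic (g : (d → ℝ) → ℂ) (x : d → ℝ) (l : d → ℤ) :
    ∑' k : d → ℤ, g (x + intVec l + intVec k) = ∑' k : d → ℤ, g (x + intVec k) := by
  rw [← (Equiv.addLeft l).tsum_eq fun k : d → ℤ => g (x + intVec k)]
  simp [intVec_add, add_assoc]

variable [Fintype d]

lemma norm_le_one_of_mem_unitCell {x : d → ℝ} (hx : x ∈ unitCell d) : ‖x‖ ≤ 1 :=
  (pi_norm_le_iff_of_nonneg zero_le_one).2 fun i => by
    rw [Real.norm_of_nonneg (hx i).1.le]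
    exact (hx i).2

lemma measurableSet_unitCell : MeasurableSet (unitCell d) :=
  MeasurableSet.univ_pi' fun _ => measurableSet_Ioc

lemma volume_unitCell : volume (unitCell d) = 1 := by
  have : unitCell d = Set.univ.pi fun _ => Set.Ioc (0 : ℝ) 1 := by
    ext x
    simp [unitCell]
  simp [this, Real.volume_pi_Ioc]

lemma hasSum_setIntegral_unitCell {E : Type*} [NormedAddCommGroup E] [NormedSpace ℝ E]
    {h : (d → ℝ) → E} (hh : Integrable h) :
    HasSum (fun k : d → ℤ => ∫ x in unitCell d, h (x + intVec k)) (∫ x, h x) := by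
  have key := hasSum_integral_iUnion (f := h) (μ := volume)
    (fun k : d → ℤ => MeasurableSet.univ_pi' fun i => measurableSet_Ioc (a := (k i : ℝ)))
    pairwise_disjoint_cells hh.integrableOn
  rw [iUnion_cells, Measure.restrict_univ] at key
  convert key using 2 with k
  rw [← preimage_add_right_unitCell k]
  exact (measurePreserving_add_right volume (intVec k)).setIntegral_preimage_emb
    (MeasurableEquiv.addRight (intVec k)).measurableEmbedding h _

lemma summable_one_add_norm_intVec_rpow {r : ℝ} (hr : (Fintype.card d : ℝ) < r) :
    Summable fun k : d → ℤ => (1 + ‖intVec k‖) ^ (-r) := by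
  have hr0 : 0 < r := (Nat.cast_nonneg _).trans_lt hr
  have hint : Integrable fun x : d → ℝ => (1 + ‖x‖) ^ (-r) :=
    integrable_one_add_norm (by simpa using hr)
  refine ((hasSum_setIntegral_unitCell hint).summable.mul_left (2 ^ r)).of_nonneg_of_le
    (fun k => by positivity) fun k => ?_
  have hle : ∀ x ∈ unitCell d,
      (2 * (1 + ‖intVec k‖)) ^ (-r) ≤ (1 + ‖x + intVec k‖) ^ (-r) := fun x hx =>
    Real.rpow_le_rpow_of_nonpos (by positivity)
      (by linarith [norm_add_le x (intVec k), norm_le_one_of_mem_unitCell hx,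
        norm_nonneg (intVec k)]) (by linarith)
  have := setIntegral_ge_of_const_le_real measurableSet_unitCell
    (by simp [volume_unitCell]) hle (hint.comp_add_right (intVec k)).integrableOn
  rw [measureReal_def, volume_unitCell, Real.mul_rpow zero_le_two (by positivity)] at this
  calc (1 + ‖intVec k‖) ^ (-r) = 2 ^ r * (2 ^ (-r) * (1 + ‖intVec k‖) ^ (-r)) := by
        rw [← mul_assoc, ← Real.rpow_add two_pos]; simp
    _ ≤ _ := by gcongr; simpa using this

variable {g : (d → ℝ) → ℂ} {C r : ℝ}

lemma norm_comp_add_intVec_le (hC : 0 ≤ C) (hr : 0 ≤ r)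
    (hg : ∀ x, ‖g x‖ ≤ C * (1 + ‖x‖) ^ (-r)) {R : ℝ} {x : d → ℝ} (hx : ‖x‖ ≤ R) (k : d → ℤ) :
    ‖g (x + intVec k)‖ ≤ C * (1 + R) ^ r * (1 + ‖intVec k‖) ^ (-r) := by
  have hR : 0 ≤ R := (norm_nonneg x).trans hx
  have h₁ : ‖intVec k‖ ≤ ‖x + intVec k‖ + ‖x‖ := by
    simpa using norm_sub_le (x + intVec k) x
  have h₂ : 1 + ‖intVec k‖ ≤ (1 + R) * (1 + ‖x + intVec k‖) := by
    nlinarith [mul_nonneg hR (norm_nonneg (x + intVec k))]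
  have h₃ := Real.rpow_le_rpow_of_nonpos (by positivity) h₂ (neg_nonpos.2 hr)
  rw [Real.mul_rpow (by positivity) (by positivity)] at h₃
  calc ‖g (x + intVec k)‖ ≤ C * (1 + ‖x + intVec k‖) ^ (-r) := hg _
    _ = C * (1 + R) ^ r * ((1 + R) ^ (-r) * (1 + ‖x + intVec k‖) ^ (-r)) := by
        have : (1 + R) ^ r * (1 + R) ^ (-r) = 1 := by
          rw [← Real.rpow_add (by positivity)]; simp
        linear_combination (-C * (1 + ‖x + intVec k‖) ^ (-r)) * this
    _ ≤ _ := by gcongr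

lemma continuous_tsum_comp_add_intVec (hc : Continuous g) (hC : 0 ≤ C)
    (hr : (Fintype.card d : ℝ) < r) (hg : ∀ x, ‖g x‖ ≤ C * (1 + ‖x‖) ^ (-r)) :
    Continuous fun x => ∑' k : d → ℤ, g (x + intVec k) := by
  refine continuous_iff_continuousAt.2 fun x₀ => ?_
  refine (continuousOn_tsum (s := Metric.closedBall 0 (‖x₀‖ + 1))
    (fun k => (hc.comp (continuous_id.add continuous_const)).continuousOn)
    ((summable_one_add_norm_intVec_rpow hr).mul_left (C * (1 + (‖x₀‖ + 1)) ^ r))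
    fun k x hx => norm_comp_add_intVec_le hC ((Nat.cast_nonneg _).trans hr.le) hg
      (mem_closedBall_zero_iff.1 hx) k).continuousAt ?_
  exact Filter.mem_of_superset (Metric.ball_mem_nhds x₀ one_pos) fun x hx => by
    rw [mem_closedBall_zero_iff]
    linarith [norm_sub_norm_le x x₀, mem_ball_iff_norm.1 hx]

lemma mFourier_coe (m : d → ℤ) (x : d → ℝ) :
    UnitAddTorus.mFourier m (fun i => (x i : UnitAddCircle)) =
      Complex.exp (Complex.I * ((2 * Real.pi * ∑ i, (m i : ℝ) * x i : ℝ) : ℂ)) := by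
  simp only [UnitAddTorus.mFourier, ContinuousMap.coe_mk, fourier_coe_apply, ← Complex.exp_sum]
  congr 1
  push_cast
  rw [Finset.mul_sum, Finset.mul_sum]
  exact Finset.sum_congr rfl fun i _ => by ring

lemma mFourier_coe_add_intVec (m k : d → ℤ) (x : d → ℝ) :
    UnitAddTorus.mFourier m (fun i => ((x + intVec k) i : UnitAddCircle)) =
      UnitAddTorus.mFourier m (fun i => (x i : UnitAddCircle)) := by
  congr 1
  ext i
  simp [intVec]

/-- The periodization of `g` descends to a continuous function on the torus. -/
lemma exists_continuousMap_torus_eq_tsum (hc : Continuous g) (hC : 0 ≤ C)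
    (hr : (Fintype.card d : ℝ) < r) (hg : ∀ x, ‖g x‖ ≤ C * (1 + ‖x‖) ^ (-r)) :
    ∃ F : C(UnitAddTorus d, ℂ), ∀ x : d → ℝ,
      F (fun i => (x i : UnitAddCircle)) = ∑' k : d → ℤ, g (x + intVec k) := by
  have hq : IsOpenQuotientMap
      (Pi.map fun (_ : d) (t : ℝ) => (t : UnitAddCircle)) :=
    .piMap fun _ => QuotientAddGroup.isOpenQuotientMap_mk
  set P : (d → ℝ) → ℂ := fun x => ∑' k : d → ℤ, g (x + intVec k) with hP
  let F : UnitAddTorus d → ℂ := P ∘ Function.surjInv hq.surjective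
  have hF : ∀ x : d → ℝ, F (Pi.map (fun (_ : d) (t : ℝ) => (t : UnitAddCircle)) x) = P x := by
    intro x
    set y := Function.surjInv hq.surjective
      (Pi.map (fun (_ : d) (t : ℝ) => (t : UnitAddCircle)) x) with hy
    have hyx := Function.surjInv_eq hq.surjective
      (Pi.map (fun (_ : d) (t : ℝ) => (t : UnitAddCircle)) x)
    rw [← hy] at hyx
    have : ∀ i, ∃ n : ℤ, y i = x i + n := fun i => by
      have h := congrFun hyx i
      simp only [Pi.map_apply] at h
      rw [← sub_eq_zero, ← AddCircle.coe_sub, AddCircle.coe_eq_zero_iff] at h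
      obtain ⟨n, hn⟩ := h
      refine ⟨n, ?_⟩
      rw [zsmul_one] at hn
      linarith
    choose l hl using this
    have hyl : y = x + intVec l := funext hl
    change P y = P x
    rw [hyl]
    exact tsum_comp_add_intVec_periodic g x l
  refine ⟨⟨F, hq.isQuotientMap.continuous_iff.2 ?_⟩, hF⟩
  exact (continuous_tsum_comp_add_intVec hc hC hr hg).congr fun x => (hF x).symm

/-- **Poisson summation** on `ℤ^d`, for a continuous function with integrable power decay and
summable Fourier transform on the lattice. -/
theorem hasSum_fourier_eq_tsum_intVec (hc : Continuous g) (hC : 0 ≤ C)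
    (hr : (Fintype.card d : ℝ) < r) (hg : ∀ x, ‖g x‖ ≤ C * (1 + ‖x‖) ^ (-r))
    (hs : Summable fun m : d → ℤ =>
      ∫ x : d → ℝ, UnitAddTorus.mFourier (-m) (fun i => (x i : UnitAddCircle)) * g x)
    (x : d → ℝ) :
    HasSum (fun m : d → ℤ =>
      (∫ y : d → ℝ, UnitAddTorus.mFourier (-m) (fun i => (y i : UnitAddCircle)) * g y) *
        UnitAddTorus.mFourier m (fun i => (x i : UnitAddCircle)))
      (∑' k : d → ℤ, g (x + intVec k)) := by
  obtain ⟨F, hF⟩ := exists_continuousMap_torus_eq_tsum hc hC hr hg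
  have hgi : Integrable g :=
    ((integrable_one_add_norm (by simpa using hr)).const_mul C).mono'
      hc.aestronglyMeasurable (.of_forall hg)
  have hcoe : ∀ m : d → ℤ, UnitAddTorus.mFourierCoeff F m =
      ∫ y : d → ℝ, UnitAddTorus.mFourier (-m) (fun i => (y i : UnitAddCircle)) * g y := by
    intro m
    have hcont : Continuous fun y : d → ℝ =>
        UnitAddTorus.mFourier (-m) (fun i => (y i : UnitAddCircle)) :=
      (UnitAddTorus.mFourier (-m)).continuous.comp
        (continuous_pi fun i => (AddCircle.continuous_mk' 1).comp (continuous_apply i))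
    have hi : Integrable fun y : d → ℝ =>
        UnitAddTorus.mFourier (-m) (fun i => (y i : UnitAddCircle)) * g y :=
      hgi.bdd_mul hcont.aestronglyMeasurable (c := 1) <| .of_forall fun y =>
        ((UnitAddTorus.mFourier (-m)).norm_coe_le_norm _).trans_eq UnitAddTorus.mFourier_norm
    rw [UnitAddTorus.mFourierCoeff_eq_integral F m 0,
      ← (hasSum_setIntegral_unitCell hi).tsum_eq,
      integral_tsum_of_summable_integral_norm
        (fun k => (hi.comp_add_right (intVec k)).integrableOn)
        (hasSum_setIntegral_unitCell hi.norm).summable]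
    simp only [Pi.zero_apply, zero_add]
    refine integral_congr_ae (.of_forall fun y => ?_)
    simp only [hF, smul_eq_mul, mFourier_coe_add_intVec, tsum_mul_left]
  have := UnitAddTorus.hasSum_mFourier_series_apply_of_summable
    (f := F) (by simpa only [← hcoe] using hs) fun i => (x i : UnitAddCircle)
  simpa only [hcoe, hF, smul_eq_mul] using this

end Poisson

lemma norm_eA (α : ℝ) {n : ℕ} (x : Fin n → ℝ) : ‖eA α x‖ = 1 := by
  rw [eA, mul_comm, Complex.norm_exp_ofReal_mul_I]

lemma eA_ne_zero (α : ℝ) {n : ℕ} (x : Fin n → ℝ) : eA α x ≠ 0 := Complex.exp_ne_zero _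

lemma eA_neg (α : ℝ) {n : ℕ} (x : Fin n → ℝ) : eA (-α) x = (eA α x)⁻¹ := by
  rw [eA, eA, ← Complex.exp_neg, Real.cos_neg, Real.sin_neg, div_neg, mul_neg,
    Complex.ofReal_neg, mul_neg]

lemma Acoef_mul_Acoef_neg {α : ℝ} (hα : Real.sin α ≠ 0) :
    Acoef α * Acoef (-α) = ((|Real.sin α|⁻¹ : ℝ) : ℂ) := by
  set t : ℝ := Real.cos α / Real.sin α with ht
  set z : ℂ := 1 - Complex.I * (t : ℂ) with hz
  have hre : z.re = 1 := by simp [hz]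
  have hconj : (1 - Complex.I * ((-t : ℝ) : ℂ)) = (starRingEnd ℂ) z := by simp [hz]
  have harg : z.arg ≠ Real.pi := fun h => by
    linarith [(Complex.arg_eq_pi_iff.1 h).1]
  have hnorm : ‖z‖ = |Real.sin α|⁻¹ := by
    rw [← abs_inv, ← Real.sqrt_sq_eq_abs, Complex.norm_eq_sqrt_sq_add_sq]
    congr 1
    have him : z.im = -t := by simp [hz]
    rw [hre, him, ht]
    field_simp
    linarith [Real.sin_sq_add_cos_sq α]
  have hA : Acoef (-α) = (starRingEnd ℂ) (z ^ (1 / 2 : ℂ)) := by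
    rw [Acoef, Real.cos_neg, Real.sin_neg, div_neg, ← ht, hconj, Complex.conj_cpow _ _ harg]
    rw [map_div₀, map_one, Complex.conj_ofNat]
  rw [hA, Acoef, ← ht, ← hz, Complex.mul_conj, Complex.normSq_eq_norm_sq, ← hnorm]
  have hn : ‖z ^ (1 / 2 : ℂ)‖ = ‖z‖ ^ (1 / 2 : ℝ) := by
    rw [show (1 / 2 : ℂ) = ((1 / 2 : ℝ) : ℂ) by simp, Complex.norm_cpow_real]
  rw [hn, ← Real.sqrt_eq_rpow, Real.sq_sqrt (norm_nonneg _)]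

lemma Acoef_ne_zero {α : ℝ} (hα : Real.sin α ≠ 0) : Acoef α ≠ 0 := fun h => by
  have := Acoef_mul_Acoef_neg hα
  rw [h, zero_mul, eq_comm, Complex.ofReal_eq_zero, inv_eq_zero, abs_eq_zero] at this
  exact hα this

lemma norm_le_sqrt_sum_sq {n : ℕ} (x : Fin n → ℝ) : ‖x‖ ≤ Real.sqrt (∑ i, x i ^ 2) :=
  (pi_norm_le_iff_of_nonneg (Real.sqrt_nonneg _)).2 fun i =>
    Real.abs_le_sqrt (Finset.single_le_sum (fun j _ => sq_nonneg (x j)) (Finset.mem_univ i))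

lemma exists_norm_comp_smul_le {n : ℕ} {f : (Fin n → ℝ) → ℂ} {C r s : ℝ} (hC : 0 ≤ C)
    (hr : 0 ≤ r) (hs : s ≠ 0)
    (hf : ∀ x : Fin n → ℝ, ‖f x‖ ≤ C / (1 + Real.sqrt (∑ i, x i ^ 2)) ^ r) :
    ∃ D, 0 ≤ D ∧ ∀ x, ‖f (s • x)‖ ≤ D * (1 + ‖x‖) ^ (-r) := by
  have hc : 0 < min 1 |s| := lt_min one_pos (abs_pos.2 hs)
  refine ⟨C * min 1 |s| ^ (-r), by positivity, fun x => (hf _).trans ?_⟩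
  have h : min 1 |s| * (1 + ‖x‖) ≤ 1 + Real.sqrt (∑ i, (s • x) i ^ 2) := by
    have h₁ := norm_le_sqrt_sum_sq (s • x)
    rw [norm_smul, Real.norm_eq_abs] at h₁
    nlinarith [min_le_left 1 |s|, mul_le_mul_of_nonneg_right (min_le_right 1 |s|) (norm_nonneg x)]
  rw [div_eq_mul_inv, ← Real.rpow_neg (by positivity), mul_assoc,
    ← Real.mul_rpow hc.le (by positivity)]
  exact mul_le_mul_of_nonneg_left
    (Real.rpow_le_rpow_of_nonpos (by positivity) h (neg_nonpos.2 hr)) hC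

lemma integral_mFourier_mul_comp_smul {α : ℝ} (hα : Real.sin α ≠ 0) {n : ℕ}
    (f : (Fin n → ℝ) → ℂ) (m : Fin n → ℤ) :
    ∫ y : Fin n → ℝ, UnitAddTorus.mFourier (-m) (fun i => (y i : UnitAddCircle)) *
        f (Real.sin α • y) =
      ((|Real.sin α|⁻¹ : ℝ) : ℂ) ^ n * ∫ x : Fin n → ℝ, f x *
        Complex.exp (-(Complex.I *
          ((2 * Real.pi * (∑ i, (m i : ℝ) * x i) / Real.sin α : ℝ) : ℂ))) := by
  have key := Measure.integral_comp_smul (volume : Measure (Fin n → ℝ)) (fun x => f x *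
    Complex.exp (-(Complex.I *
      ((2 * Real.pi * (∑ i, (m i : ℝ) * x i) / Real.sin α : ℝ) : ℂ)))) (Real.sin α)
  rw [Module.finrank_fin_fun, abs_inv, abs_pow, ← inv_pow, Complex.real_smul,
    Complex.ofReal_pow] at key
  rw [← key]
  congr 1 with y
  rw [mFourier_coe, mul_comm]
  congr 2
  rw [← mul_neg, ← Complex.ofReal_neg]
  congr 2
  have : ∑ i, (m i : ℝ) * (Real.sin α • y) i = Real.sin α * ∑ i, (m i : ℝ) * y i := by
    rw [Finset.mul_sum]
    exact Finset.sum_congr rfl fun i _ => by simp only [Pi.smul_apply, smul_eq_mul]; ring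
  rw [this]
  simp only [Pi.neg_apply, Int.cast_neg, neg_mul, Finset.sum_neg_distrib]
  field_simp

lemma Fhat_mul_Kk_neg {α : ℝ} (hα : Real.sin α ≠ 0) {n : ℕ} (f : (Fin n → ℝ) → ℂ)
    (m : Fin n → ℤ) (x : Fin n → ℝ) :
    Fhat α f m * Kk (-α) m x = (eA α x)⁻¹ *
      ((∫ y : Fin n → ℝ, UnitAddTorus.mFourier (-m) (fun i => (y i : UnitAddCircle)) *
        f (Real.sin α • y)) *
        UnitAddTorus.mFourier m fun i => (((Real.sin α)⁻¹ • x) i : UnitAddCircle)) := by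
  have hexp : Complex.exp (-(Complex.I *
      ((2 * Real.pi * (∑ i, (m i : ℝ) * x i) / Real.sin (-α) : ℝ) : ℂ))) =
      UnitAddTorus.mFourier m fun i => (((Real.sin α)⁻¹ • x) i : UnitAddCircle) := by
    rw [mFourier_coe, Real.sin_neg, div_neg, Complex.ofReal_neg, mul_neg, neg_neg]
    congr 3
    rw [mul_div_assoc, Finset.sum_div]
    congr 1
    exact Finset.sum_congr rfl fun i _ => by simp only [Pi.smul_apply, smul_eq_mul]; ring
  rw [integral_mFourier_mul_comp_smul hα, ← Acoef_mul_Acoef_neg hα, mul_pow, Fhat, Kk, hexp,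
    eA_neg, eA_neg]
  have := eA_ne_zero α fun i => (m i : ℝ)
  field_simp

lemma summable_integral_mFourier_mul_comp_smul {α : ℝ} (hα : Real.sin α ≠ 0) {n : ℕ}
    {f : (Fin n → ℝ) → ℂ} (hf : Summable fun m : Fin n → ℤ => ‖Fhat α f m‖) :
    Summable fun m : Fin n → ℤ =>
      ∫ y : Fin n → ℝ, UnitAddTorus.mFourier (-m) (fun i => (y i : UnitAddCircle)) *
        f (Real.sin α • y) := by
  refine .of_norm ((hf.mul_left ((|Real.sin α|⁻¹) ^ n * (‖Acoef α‖ ^ n)⁻¹)).congr fun m => ?_)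
  have := norm_ne_zero_iff.2 (Acoef_ne_zero hα)
  rw [integral_mFourier_mul_comp_smul hα, Fhat]
  simp only [norm_mul, norm_pow, norm_eA, Complex.norm_real, Real.norm_eq_abs, abs_inv, abs_abs]
  field_simp

lemma tsum_comp_add_mul_abs {n : ℕ} (f : (Fin n → ℝ) → ℂ) (x : Fin n → ℝ) (s : ℝ) :
    ∑' k : Fin n → ℤ, f (fun i => x i + k i * |s|) =
      ∑' k : Fin n → ℤ, f (fun i => x i + k i * s) := by
  rcases abs_cases s with ⟨h, -⟩ | ⟨h, -⟩
  · rw [h]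
  · rw [h, ← (Equiv.neg (Fin n → ℤ)).tsum_eq]
    simp

theorem stmt17 (α : ℝ) (hα : ∀ k : ℤ, α ≠ k * Real.pi) (n : ℕ)
    (f : (Fin n → ℝ) → ℂ) (hc : Continuous f)
    (C δ : ℝ) (hC : 0 < C) (hδ : 0 < δ)
    (hbound : ∀ x : Fin n → ℝ,
      ‖f x‖ ≤ C / (1 + Real.sqrt (∑ i, x i ^ 2)) ^ ((n : ℝ) + δ))
    (hsum : Summable fun m : Fin n → ℤ => ‖Fhat α f m‖) :
    ∀ x : Fin n → ℝ,
      ∑' m : Fin n → ℤ, Fhat α f m * Kk (-α) m x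
        = (eA α x)⁻¹ * ∑' k : Fin n → ℤ, f fun i => x i + k i * |Real.sin α| := by
  intro x
  have hs : Real.sin α ≠ 0 := fun h => by
    obtain ⟨k, hk⟩ := Real.sin_eq_zero_iff.1 h
    exact hα k hk.symm
  obtain ⟨D, hD, hbd⟩ := exists_norm_comp_smul_le hC.le (by positivity) hs hbound
  have hP := hasSum_fourier_eq_tsum_intVec (g := fun y => f (Real.sin α • y))
    (hc.comp (continuous_const_smul _)) hD (by simpa using hδ) hbd
    (summable_integral_mFourier_mul_comp_smul hs hsum) ((Real.sin α)⁻¹ • x)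
  simp_rw [Fhat_mul_Kk_neg hs, tsum_mul_left, hP.tsum_eq, tsum_comp_add_mul_abs]
  congr 2 with k
  congr 1 with i
  simp only [intVec, Pi.smul_apply, Pi.add_apply, smul_eq_mul]
  field_simp
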